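/- arXiv:1802.05576 — 4 statements merged into one kernel-verified Lean document; each statement's English description precedes it below -/
import Mathlib

section
/- Let g be a Lie algebra over a field k and let ω : g → k be a linear functional such that for all u,v,t ∈ g: ω(u)·ω(⁅v,t⁆) + ω(v)·ω(⁅t,u⁆) + ω(t)·ω(⁅u,v⁆) = 0 (i.e. ω ∧ δω = 0, where δ is the Chevalley–Eilenberg coboundary). Then the triple product [x,y,z] := ω(x)·⁅y,z⁆ + ω(y)·⁅z,x⁆ + ω(z)·⁅x,y⁆ satisfies the ternary Filippov–Jacobi identity: for all x,y,u,v,t ∈ g, [x,y,[u,v,t]] = [[x,y,u],v,t] + [u,[x,y,v],t] + [u,v,[x,y,t]]. -/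
/-- The triple product on a Lie algebra induced by a linear functional `ω`:
`[x,y,z] := ω(x)·⁅y,z⁆ + ω(y)·⁅z,x⁆ + ω(z)·⁅x,y⁆`. -/
def inducedTriple {k g : Type*} [Field k] [LieRing g] [LieAlgebra k g]
    (ω : g →ₗ[k] k) (x y z : g) : g :=
  ω x • ⁅y, z⁆ + ω y • ⁅z, x⁆ + ω z • ⁅x, y⁆

theorem inducedTriple_def {k g : Type*} [Field k] [LieRing g] [LieAlgebra k g]
    (ω : g →ₗ[k] k) (x y z : g) :
    inducedTriple ω x y z = ω x • ⁅y, z⁆ + ω y • ⁅z, x⁆ + ω z • ⁅x, y⁆ :=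
  rfl

/-- If `ω ∧ δω = 0`, then `ω` vanishes on all induced triple products. -/
theorem apply_inducedTriple_eq_zero {k g : Type*} [Field k] [LieRing g]
    [LieAlgebra k g] (ω : g →ₗ[k] k)
    (hω : ∀ u v t : g, ω u * ω ⁅v, t⁆ + ω v * ω ⁅t, u⁆ + ω t * ω ⁅u, v⁆ = 0) (u v t : g) :
    ω (inducedTriple ω u v t) = 0 := by
  simpa [inducedTriple] using hω u v t

/-- If `ω ∧ δω = 0`, i.e. `ω(u)ω(⁅v,t⁆) + ω(v)ω(⁅t,u⁆) + ω(t)ω(⁅u,v⁆) = 0` for all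
`u,v,t`, then the induced triple product satisfies the ternary Filippov–Jacobi
identity. -/
theorem inducedTriple_filippov_of_wedge_eq_zero {k g : Type*} [Field k] [LieRing g]
    [LieAlgebra k g] (ω : g →ₗ[k] k)
    (hω : ∀ u v t : g, ω u * ω ⁅v, t⁆ + ω v * ω ⁅t, u⁆ + ω t * ω ⁅u, v⁆ = 0) :
    ∀ x y u v t : g,
      inducedTriple ω x y (inducedTriple ω u v t) =
        inducedTriple ω (inducedTriple ω x y u) v t +
        inducedTriple ω u (inducedTriple ω x y v) t +
        inducedTriple ω u v (inducedTriple ω x y t) := by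
  intro x y u v t
  have h := apply_inducedTriple_eq_zero ω hω
  rw [inducedTriple_def ω x y (inducedTriple ω u v t),
    inducedTriple_def ω (inducedTriple ω x y u) v t,
    inducedTriple_def ω u (inducedTriple ω x y v) t,
    inducedTriple_def ω u v (inducedTriple ω x y t), h, h, h, h]
  simp only [zero_smul, add_zero, zero_add]
  rw [← lie_skew (inducedTriple ω u v t) x, ← lie_skew (inducedTriple ω x y u) v,
    ← lie_skew (inducedTriple ω x y v) t, ← lie_skew (inducedTriple ω x y t) u]
  simp only [inducedTriple, lie_add, lie_smul]
  rw [← lie_skew u x, ← lie_skew v x, ← lie_skew t x]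
  rw [leibniz_lie x u v, leibniz_lie x v t, leibniz_lie x t u,
    leibniz_lie y u v, leibniz_lie y v t, leibniz_lie y t u,
    ← lie_skew ⁅x, u⁆ v, ← lie_skew ⁅x, v⁆ t, ← lie_skew ⁅x, t⁆ u,
    ← lie_skew ⁅y, u⁆ v, ← lie_skew ⁅y, v⁆ t, ← lie_skew ⁅y, t⁆ u]
  simp only [lie_neg]
  module
end

section
/- Let g be a Lie algebra over a field k and let ω : g → k be a linear functional that vanishes on all commutators, i.e. ω(⁅x,y⁆) = 0 for all x,y ∈ g (ω is a 1-cocycle of the Chevalley–Eilenberg complex with trivial coefficients). Then the triple product [x,y,z] := ω(x)·⁅y,z⁆ + ω(y)·⁅z,x⁆ + ω(z)·⁅x,y⁆ satisfies the ternary Filippov–Jacobi identity: for all x,y,u,v,t ∈ g, [x,y,[u,v,t]] = [[x,y,u],v,t] + [u,[x,y,v],t] + [u,v,[x,y,t]]. -/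
/-- If `ω` vanishes on all commutators (i.e. `ω` is a Chevalley–Eilenberg
1-cocycle with trivial coefficients), then the induced triple product satisfies
the ternary Filippov–Jacobi identity. -/
theorem inducedTriple_filippov_of_cocycle {k g : Type*} [Field k] [LieRing g]
    [LieAlgebra k g] (ω : g →ₗ[k] k)
    (hω : ∀ x y : g, ω ⁅x, y⁆ = 0) :
    ∀ x y u v t : g,
      inducedTriple ω x y (inducedTriple ω u v t) =
        inducedTriple ω (inducedTriple ω x y u) v t +
        inducedTriple ω u (inducedTriple ω x y v) t +
        inducedTriple ω u v (inducedTriple ω x y t) := by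
  intro x y u v t
  have lie_swap (a b c : g) : ⁅⁅a, b⁆, c⁆ = -⁅c, ⁅a, b⁆⁆ := (lie_skew _ _).symm
  have jacobi (a b c : g) : ⁅a, ⁅b, c⁆⁆ = ⁅b, ⁅a, c⁆⁆ - ⁅c, ⁅a, b⁆⁆ := by
    rw [leibniz_lie, lie_swap]; abel
  simp only [inducedTriple, map_add, map_smul, hω, smul_zero, add_zero, zero_smul,
    lie_add, add_lie, lie_smul, smul_lie, smul_add, lie_swap]
  simp only [← lie_skew u x, ← lie_skew v x, ← lie_skew t x, ← lie_skew t u, lie_neg]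
  rw [jacobi y v t, jacobi y u t, jacobi y u v, jacobi x v t, jacobi x u t, jacobi x u v]
  module
end

section
/- Let n be a positive integer and let A, B, C, X, Y, U, V, T denote n×n matrices over ℂ. Define the quantum Nambu bracket [A,B,C] := Tr(A)·(BC − CB) + Tr(B)·(CA − AC) + Tr(C)·(AB − BA). Then this bracket satisfies the ternary Filippov–Jacobi identity: for all n×n matrices X, Y, U, V, T over ℂ, [X,Y,[U,V,T]] = [[X,Y,U],V,T] + [U,[X,Y,V],T] + [U,V,[X,Y,T]]. -/
/-- The quantum Nambu bracket of square matrices: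
`[A,B,C] := Tr(A)·(BC − CB) + Tr(B)·(CA − AC) + Tr(C)·(AB − BA)`. -/
noncomputable def quantumNambu {n : ℕ} (A B C : Matrix (Fin n) (Fin n) ℂ) :
    Matrix (Fin n) (Fin n) ℂ :=
  A.trace • (B * C - C * B) + B.trace • (C * A - A * C) + C.trace • (A * B - B * A)

theorem quantumNambu_apply {n : ℕ} (A B C : Matrix (Fin n) (Fin n) ℂ) :
    quantumNambu A B C =
      A.trace • (B * C - C * B) + B.trace • (C * A - A * C) + C.trace • (A * B - B * A) :=
  rfl

theorem trace_quantumNambu {n : ℕ} (A B C : Matrix (Fin n) (Fin n) ℂ) :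
    (quantumNambu A B C).trace = 0 := by
  simp only [quantumNambu, Matrix.trace_add, Matrix.trace_smul, Matrix.trace_sub,
    Matrix.trace_mul_comm B C, Matrix.trace_mul_comm C A, Matrix.trace_mul_comm A B,
    sub_self, smul_zero, add_zero]

/-- The quantum Nambu bracket of `n × n` complex matrices satisfies the ternary
Filippov–Jacobi identity. -/
theorem quantumNambu_filippov (n : ℕ) (hn : 0 < n)
    (X Y U V T : Matrix (Fin n) (Fin n) ℂ) :
    quantumNambu X Y (quantumNambu U V T) =
      quantumNambu (quantumNambu X Y U) V T +
      quantumNambu U (quantumNambu X Y V) T +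
      quantumNambu U V (quantumNambu X Y T) := by
  rw [quantumNambu_apply X Y (quantumNambu U V T), quantumNambu_apply (quantumNambu X Y U),
    quantumNambu_apply U (quantumNambu X Y V), quantumNambu_apply U V (quantumNambu X Y T)]
  simp only [trace_quantumNambu, zero_smul, add_zero, zero_add]
  simp only [quantumNambu, mul_add, add_mul, mul_sub, sub_mul, Matrix.smul_mul, Matrix.mul_smul,
    Matrix.mul_assoc]
  module
end

section
/- Let g be a Lie algebra over a field k, let n ≥ 2 be an integer, and let ω : g^(n−2) → k be an alternating multilinear map in n−2 variables. Define the n-ary product [x₁,…,xₙ] := Σ_{1≤i<j≤n} (−1)^(i+j+1) · ω(x₁,…,x̂ᵢ,…,x̂ⱼ,…,xₙ) · ⁅xᵢ,xⱼ⁆, where x̂ᵢ, x̂ⱼ means the arguments xᵢ and xⱼ are omitted. Then this n-ary product is totally skew-symmetric: for every permutation σ of {1,…,n}, [x_{σ(1)},…,x_{σ(n)}] = sgn(σ)·[x₁,…,xₙ]. -/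
/-- Remove the entries at two positions `i < j` from a `p`-tuple, obtaining a
`(p-2)`-tuple (the remaining entries in their original order). -/
def removeTwo {α : Type*} {p : ℕ} (x : Fin p → α) (i j : Fin p)
    (h : i.val < j.val) : Fin (p - 2) → α :=
  fun l =>
    have hl := l.2
    have hj := j.2
    if l.val < i.val then x ⟨l.val, by omega⟩
    else if l.val + 1 < j.val then x ⟨l.val + 1, by omega⟩
    else x ⟨l.val + 2, by omega⟩

/-- The `n`-ary product (`n = m + 2`) on a Lie algebra induced by an alternating
`(n-2)`-form `ω`:
`[x₁,…,xₙ] = Σ_{i<j} (−1)^(i+j+1) ω(x₁,…,x̂ᵢ,…,x̂ⱼ,…,xₙ) ⁅xᵢ,xⱼ⁆`. -/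
def naryBracket {k g : Type*} [Field k] [LieRing g] [LieAlgebra k g] {m : ℕ}
    (ω : AlternatingMap k g k (Fin m)) (x : Fin (m + 2) → g) : g :=
  ∑ i : Fin (m + 2), ∑ j : Fin (m + 2),
    if h : i.val < j.val then
      ((-1 : k) ^ (i.val + j.val + 1) * ω (removeTwo x i j h)) • ⁅x i, x j⁆
    else 0

/-- The position in the original tuple of the `l`-th entry that survives `removeTwo`. -/
theorem exists_removeTwo_eq {p : ℕ} {i j : Fin p} (h : i.val < j.val) (l : Fin (p - 2)) :
    ∃ q : Fin p, q.val = (if l.val < i.val then l.val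
        else if l.val + 1 < j.val then l.val + 1 else l.val + 2) ∧
      ∀ {α : Type*} (x : Fin p → α), removeTwo x i j h l = x q := by
  have hl := l.2
  have hj := j.2
  refine ⟨⟨if l.val < i.val then l.val
        else if l.val + 1 < j.val then l.val + 1 else l.val + 2, ?_⟩, rfl, fun x => ?_⟩
  · split_ifs <;> omega
  · unfold removeTwo
    dsimp only
    split_ifs <;> rfl

theorem Fin.val_swap_apply {n : ℕ} (a b c : Fin n) :
    (Equiv.swap a b c).val =
      if c.val = a.val then b.val else if c.val = b.val then a.val else c.val := by
  rw [Equiv.swap_apply_def]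
  simp only [Fin.ext_iff]
  split_ifs <;> rfl

theorem removeTwo_comp_swap {α : Type*} {p : ℕ} (x : Fin p → α) {i j i' j' : Fin p}
    (h : i.val < j.val) (h' : i'.val < j'.val) {a b : Fin p} (hab : b.val = a.val + 1)
    (hi' : i'.val = i.val ∧ j'.val = j.val ∧ i = a ∧ j = b ∨
      i' = Equiv.swap a b i ∧ j' = Equiv.swap a b j ∧
        (i = a ∨ i = b ∨ j = a ∨ j = b)) :
    removeTwo (x ∘ Equiv.swap a b) i j h = removeTwo x i' j' h' := by
  funext l
  obtain ⟨q, hq, hx⟩ := exists_removeTwo_eq h l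
  obtain ⟨q', hq', hx'⟩ := exists_removeTwo_eq h' l
  rw [hx, hx', Function.comp_apply]
  congr 1
  simp only [Fin.ext_iff, Fin.val_swap_apply] at hi' ⊢
  grind

theorem exists_removeTwo_comp_swap {α : Type*} {p : ℕ} (x : Fin p → α) {i j : Fin p}
    (h : i.val < j.val) {a b : Fin p} (hab : b.val = a.val + 1)
    (hia : i ≠ a) (hib : i ≠ b) (hja : j ≠ a) (hjb : j ≠ b) :
    ∃ c d : Fin (p - 2), c ≠ d ∧
      removeTwo (x ∘ Equiv.swap a b) i j h = removeTwo x i j h ∘ Equiv.swap c d := by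
  simp only [ne_eq, Fin.ext_iff] at hia hib hja hjb
  have hb := b.2
  have hj := j.2
  obtain ⟨c, hc⟩ : ∃ c : ℕ, c = if a.val < i.val then a.val
    else if a.val < j.val then a.val - 1 else a.val - 2 := ⟨_, rfl⟩
  have hcp : c + 1 < p - 2 := by split_ifs at hc <;> omega
  refine ⟨⟨c, by omega⟩, ⟨c + 1, hcp⟩, by simp [Fin.ext_iff], ?_⟩
  funext l
  obtain ⟨q, hq, hx⟩ := exists_removeTwo_eq h l
  obtain ⟨q', hq', hx'⟩ := exists_removeTwo_eq h
    (Equiv.swap (⟨c, by omega⟩ : Fin (p - 2)) ⟨c + 1, hcp⟩ l)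
  rw [Function.comp_apply, hx, hx', Function.comp_apply]
  congr 1
  simp only [Fin.ext_iff, Fin.val_swap_apply] at hq' ⊢
  grind (splits := 20)

/-- The summand of `naryBracket` at a pair of positions. -/
def naryBracketTerm {k g : Type*} [Field k] [LieRing g] [LieAlgebra k g] {m : ℕ}
    (ω : AlternatingMap k g k (Fin m)) (x : Fin (m + 2) → g)
    (q : Fin (m + 2) × Fin (m + 2)) : g :=
  if h : q.1.val < q.2.val then
    ((-1 : k) ^ (q.1.val + q.2.val + 1) * ω (removeTwo x q.1 q.2 h)) • ⁅x q.1, x q.2⁆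
  else 0

section

variable {k g : Type*} [Field k] [LieRing g] [LieAlgebra k g] {m : ℕ}
  (ω : AlternatingMap k g k (Fin m)) (x : Fin (m + 2) → g)

theorem naryBracket_eq_sum_term :
    naryBracket ω x = ∑ q, naryBracketTerm ω x q :=
  (Fintype.sum_prod_type (naryBracketTerm ω x)).symm

theorem naryBracketTerm_comp_swap {a b : Fin (m + 2)} (hab : b.val = a.val + 1)
    (i j : Fin (m + 2)) :
    naryBracketTerm ω (x ∘ Equiv.swap a b) (i, j) =
      -naryBracketTerm ω x
        (Equiv.swap (a, b) (b, a) (Equiv.swap a b i, Equiv.swap a b j)) := by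
  have hne : a ≠ b := by simp [Fin.ext_iff, hab]
  by_cases h₁ : i = a ∧ j = b
  · obtain ⟨rfl, rfl⟩ := h₁
    have h : i.val < j.val := by omega
    rw [Equiv.swap_apply_left, Equiv.swap_apply_right, Equiv.swap_apply_right]
    simp only [naryBracketTerm, h, dif_pos, Function.comp_apply, Equiv.swap_apply_left,
      Equiv.swap_apply_right]
    rw [removeTwo_comp_swap x h h hab (Or.inl ⟨rfl, rfl, rfl, rfl⟩), ← lie_skew, smul_neg]
  by_cases h₂ : i = b ∧ j = a
  · obtain ⟨rfl, rfl⟩ := h₂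
    have h : ¬ i.val < j.val := by omega
    simp [naryBracketTerm, h]
  have hfix : Equiv.swap (a, b) (b, a) (Equiv.swap a b i, Equiv.swap a b j) =
      (Equiv.swap a b i, Equiv.swap a b j) := by
    apply Equiv.swap_apply_of_ne_of_ne
    · intro e
      simp only [Prod.mk.injEq, Equiv.swap_apply_eq_iff, Equiv.swap_apply_left,
        Equiv.swap_apply_right] at e
      exact h₂ e
    · intro e
      simp only [Prod.mk.injEq, Equiv.swap_apply_eq_iff, Equiv.swap_apply_left,
        Equiv.swap_apply_right] at e
      exact h₁ e
  rw [hfix]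
  have hlt : (Equiv.swap a b i).val < (Equiv.swap a b j).val ↔ i.val < j.val := by
    simp only [Fin.ext_iff, Fin.val_swap_apply] at h₁ h₂ ⊢
    grind
  by_cases h : i.val < j.val
  swap
  · simp [naryBracketTerm, h, hlt]
  have h' := hlt.2 h
  simp only [naryBracketTerm, h, h', dif_pos, Function.comp_apply]
  rw [← neg_smul]
  congr 1
  by_cases hmeet : i = a ∨ i = b ∨ j = a ∨ j = b
  · rw [removeTwo_comp_swap x h h' hab (Or.inr ⟨rfl, rfl, hmeet⟩), ← neg_mul]
    congr 1
    have hexp : (Equiv.swap a b i).val + (Equiv.swap a b j).val = i.val + j.val + 1 ∨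
        i.val + j.val = (Equiv.swap a b i).val + (Equiv.swap a b j).val + 1 := by
      simp only [Fin.ext_iff, Fin.val_swap_apply] at h₁ h₂ hmeet ⊢
      grind
    rcases hexp with e | e <;> rw [e] <;> ring
  · push Not at hmeet
    obtain ⟨hia, hib, hja, hjb⟩ := hmeet
    obtain ⟨c, d, hcd, e⟩ := exists_removeTwo_comp_swap x h hab hia hib hja hjb
    have hω : ω (removeTwo (x ∘ Equiv.swap a b) i j h) = -ω (removeTwo x i j h) := by
      rw [e]
      exact ω.map_swap (removeTwo x i j h) hcd
    have hrem : ∀ {i' j' : Fin (m + 2)} (h' : i'.val < j'.val), i' = i → j' = j →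
        removeTwo x i' j' h' = removeTwo x i j h := by
      rintro _ _ _ rfl rfl
      rfl
    have hi := Equiv.swap_apply_of_ne_of_ne hia hib
    have hj := Equiv.swap_apply_of_ne_of_ne hja hjb
    rw [hrem h' hi hj, hi, hj, hω, mul_neg]

theorem naryBracket_comp_swap {a b : Fin (m + 2)} (hab : b.val = a.val + 1) :
    naryBracket ω (x ∘ Equiv.swap a b) = -naryBracket ω x := by
  rw [naryBracket_eq_sum_term, naryBracket_eq_sum_term, ← Finset.sum_neg_distrib,
    ← Equiv.sum_comp (((Equiv.swap a b).prodCongr (Equiv.swap a b)).trans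
      (Equiv.swap (a, b) (b, a))) fun q => -naryBracketTerm ω x q]
  exact Finset.sum_congr rfl fun q _ => naryBracketTerm_comp_swap ω x hab q.1 q.2

end

/-- The induced `n`-ary product is totally skew-symmetric: for every permutation
`σ` of the `n` arguments, `[x_{σ(1)},…,x_{σ(n)}] = sgn(σ)·[x₁,…,xₙ]`. -/
theorem naryBracket_skew_symmetric {k g : Type*} [Field k] [LieRing g]
    [LieAlgebra k g] {m : ℕ} (ω : AlternatingMap k g k (Fin m))
    (x : Fin (m + 2) → g) (σ : Equiv.Perm (Fin (m + 2))) :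
    naryBracket ω (x ∘ σ) = (Equiv.Perm.sign σ : ℤ) • naryBracket ω x := by
  have hσ : σ ∈ Submonoid.closure
      (Set.range fun i : Fin (m + 1) => Equiv.swap i.castSucc i.succ) := by
    rw [Equiv.Perm.mclosure_swap_castSucc_succ]
    exact Submonoid.mem_top σ
  induction hσ using Submonoid.closure_induction_right with
  | one => simp
  | mul_right σ _ τ hτ ih =>
    obtain ⟨i, rfl⟩ := hτ
    rw [Equiv.Perm.coe_mul, ← Function.comp_assoc,
      naryBracket_comp_swap ω (x ∘ σ) (by simp), ih, Equiv.Perm.sign_mul,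
      Equiv.Perm.sign_swap (Fin.castSucc_lt_succ).ne]
    simp
end
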